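/- Let X₁,…,X_{2N} be independent uniform random variables on [0,1] with order statistics X₍₁₎ ≤ … ≤ X₍₂N₎ (and X₍₀₎ = 0, X₍₂N+1₎ = 1). Then for every real p > −1 and every l ∈ {0,1,…,2N}, E[ (X₍l+1₎ − X₍l₎)^p ] = Γ(2N+1)Γ(1+p) / Γ(2N+1+p). In particular, the average optimal cost per edge of the random Euclidean matching problem of 2N uniform points on [0,1] with cost z^p, p > 1, equals Γ(2N+1)Γ(1+p)/Γ(2N+1+p). -/

import Mathlib

open MeasureTheory

/-- The uniform probability measure on `[0,1]`. -/
noncomputable def unif : Measure ℝ := volume.restrict (Set.Icc 0 1)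

/-- The law of `n` independent uniform points on `[0,1]`. -/
noncomputable def unifPi (n : ℕ) : Measure (Fin n → ℝ) :=
  Measure.pi fun _ => unif

/-- The `l`-th order statistic of a sample of `n` points, with the conventions
`X₍₀₎ = 0` and `X₍ₙ₊₁₎ = 1`. -/
noncomputable def ostatExt {n : ℕ} (ω : Fin n → ℝ) (l : ℕ) : ℝ :=
  if h : 1 ≤ l ∧ l ≤ n then ω (Tuple.sort ω ⟨l - 1, by omega⟩)
  else if l = 0 then 0 else 1

/-- The `l`-th spacing `φ_l = X₍l+1₎ − X₍l₎` of a sample. -/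
noncomputable def spacing {n : ℕ} (ω : Fin n → ℝ) (l : ℕ) : ℝ :=
  ostatExt ω (l + 1) - ostatExt ω l

open Set ProbabilityTheory
open scoped Pointwise

lemma ostatExt_zero {n : ℕ} (ω : Fin n → ℝ) : ostatExt ω 0 = 0 := by
  simp [ostatExt]

lemma ostatExt_of_lt {n l : ℕ} (ω : Fin n → ℝ) (h : n < l) : ostatExt ω l = 1 := by
  rw [ostatExt, dif_neg (by omega), if_neg (by omega)]

lemma ostatExt_val_add_one {n : ℕ} (ω : Fin n → ℝ) (k : Fin n) :
    ostatExt ω (k + 1) = ω (Tuple.sort ω k) := by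
  rw [ostatExt, dif_pos (by omega)]
  simp

lemma ostatExt_cases {n : ℕ} {P : ℕ → Prop} (zero : P 0) (lt : ∀ l, n < l → P l)
    (val : ∀ k : Fin n, P (k + 1)) (l : ℕ) : P l := by
  rcases l with _ | l
  · exact zero
  · rcases lt_or_ge l n with h | h
    · exact val ⟨l, h⟩
    · exact lt _ (by omega)

lemma ostatExt_mem_Icc {n : ℕ} {ω : Fin n → ℝ} (hω : ω ∈ univ.pi fun _ => Icc (0 : ℝ) 1) (l : ℕ) :
    ostatExt ω l ∈ Icc (0 : ℝ) 1 := by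
  refine ostatExt_cases (n := n) (P := fun l => ostatExt ω l ∈ Icc (0 : ℝ) 1) ?_ ?_ ?_ l
  · simp [ostatExt_zero]
  · intro l hl
    simp [ostatExt_of_lt ω hl]
  · intro k
    rw [ostatExt_val_add_one]
    exact hω _ (mem_univ _)

lemma monotone_ostatExt {n : ℕ} {ω : Fin n → ℝ} (hω : ω ∈ univ.pi fun _ => Icc (0 : ℝ) 1) :
    Monotone (ostatExt ω) := by
  refine monotone_nat_of_le_succ fun l => ?_
  rcases l with _ | l
  · rw [ostatExt_zero]
    exact (ostatExt_mem_Icc hω _).1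
  · rcases lt_or_ge (l + 1) n with h | h
    · rw [ostatExt_val_add_one ω ⟨l, by omega⟩, ostatExt_val_add_one ω ⟨l + 1, h⟩]
      exact Tuple.monotone_sort ω (by simp)
    · rw [ostatExt_of_lt ω (l := l + 1 + 1) (by omega)]
      exact (ostatExt_mem_Icc hω _).2

lemma apply_sort_le_iff {n : ℕ} (ω : Fin n → ℝ) (k : Fin n) (t : ℝ) :
    ω (Tuple.sort ω k) ≤ t ↔ ∃ σ : Equiv.Perm (Fin n), Monotone (ω ∘ σ) ∧ ω (σ k) ≤ t := by
  refine ⟨fun h => ⟨_, Tuple.monotone_sort ω, h⟩, fun ⟨σ, hσ, h⟩ => ?_⟩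
  have := congrFun (Tuple.comp_sort_eq_comp_iff_monotone.2 hσ) k
  simp only [Function.comp_apply] at this
  rwa [← this]

lemma measurableSet_monotone_comp {n : ℕ} (σ : Equiv.Perm (Fin n)) :
    MeasurableSet {ω : Fin n → ℝ | Monotone (ω ∘ σ)} := by
  simp only [Monotone, Function.comp_apply, ofPred_forall]
  exact .iInter fun i => .iInter fun j => .iInter fun _ =>
    measurableSet_le (measurable_pi_apply _) (measurable_pi_apply _)

lemma measurable_ostatExt {n : ℕ} (l : ℕ) :
    Measurable fun ω : Fin n → ℝ => ostatExt ω l := by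
  refine ostatExt_cases (n := n) (P := fun l => Measurable fun ω : Fin n → ℝ => ostatExt ω l)
    ?_ ?_ ?_ l
  · simp [ostatExt_zero]
  · intro l hl
    simp [ostatExt_of_lt _ hl]
  · intro k
    refine measurable_of_Iic fun t => ?_
    have : (fun ω : Fin n → ℝ => ostatExt ω (k + 1)) ⁻¹' Iic t =
        ⋃ σ : Equiv.Perm (Fin n), {ω | Monotone (ω ∘ σ)} ∩ {ω | ω (σ k) ≤ t} := by
      ext ω
      simp only [mem_preimage, mem_Iic, ostatExt_val_add_one, apply_sort_le_iff, mem_iUnion,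
        mem_inter_iff, mem_ofPred_eq]
    rw [this]
    exact .iUnion fun σ => (measurableSet_monotone_comp σ).inter
      (measurableSet_le (measurable_pi_apply _) measurable_const)

lemma measurable_spacing {n : ℕ} (l : ℕ) : Measurable fun ω : Fin n → ℝ => spacing ω l :=
  (measurable_ostatExt _).sub (measurable_ostatExt _)

lemma measurableSet_sort_eq {n : ℕ} (σ : Equiv.Perm (Fin n)) :
    MeasurableSet {ω : Fin n → ℝ | Tuple.sort ω = σ} := by
  simp only [eq_comm (b := σ), Tuple.eq_sort_iff, ofPred_and, ofPred_forall]
  refine (measurableSet_monotone_comp σ).inter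
    (.iInter fun i => .iInter fun j => .iInter fun _ => ?_)
  by_cases h : σ i < σ j
  · simp [h]
  · simp only [h, imp_false]
    exact (measurableSet_eq_fun (f := fun ω : Fin n → ℝ => ω (σ i)) (g := fun ω => ω (σ j))
      (measurable_pi_apply _) (measurable_pi_apply _)).compl

lemma sort_eq_of_sort_eq {n : ℕ} {u w : Fin n → ℝ} {σ : Equiv.Perm (Fin n)} (hu : Tuple.sort u = σ)
    (h : ∀ i j, i < j → u (σ i) ≤ u (σ j) →
      w (σ i) ≤ w (σ j) ∧ (w (σ i) = w (σ j) → u (σ i) = u (σ j))) :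
    Tuple.sort w = σ := by
  obtain ⟨hmono, hties⟩ := Tuple.eq_sort_iff.1 hu.symm
  refine (Tuple.eq_sort_iff.2 ⟨monotone_iff_forall_lt.2 fun i j hij => ?_, fun i j hij e => ?_⟩).symm
  · exact (h i j hij (hmono hij.le)).1
  · exact hties i j hij ((h i j hij (hmono hij.le)).2 e)

/-- Contract the sample by `1 - t` and move the points of rank at least `l` (ranks being counted
from `0` along `σ`) up by `t`, which opens a gap of size `t`. -/
noncomputable def openGap {n : ℕ} (σ : Equiv.Perm (Fin n)) (l : ℕ) (t : ℝ) (ω : Fin n → ℝ) :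
    Fin n → ℝ :=
  (fun i => if (σ.symm i : ℕ) < l then 0 else t) + (1 - t) • ω

lemma openGap_apply_perm {n : ℕ} (σ : Equiv.Perm (Fin n)) (l : ℕ) (t : ℝ) (ω : Fin n → ℝ)
    (k : Fin n) :
    openGap σ l t ω (σ k) = (if (k : ℕ) < l then 0 else t) + (1 - t) * ω (σ k) := by
  simp [openGap]

lemma volume_image_openGap {n : ℕ} (σ : Equiv.Perm (Fin n)) (l : ℕ) {t : ℝ} (ht : t ≤ 1)
    (s : Set (Fin n → ℝ)) :
    volume (openGap σ l t '' s) = ENNReal.ofReal ((1 - t) ^ n) * volume s := by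
  have : openGap σ l t '' s =
      (fun ω => (fun i => if (σ.symm i : ℕ) < l then (0 : ℝ) else t) + ω) '' ((1 - t) • s) := by
    rw [← image_smul, image_image]
    rfl
  rw [this, image_add_left, measure_preimage_add,
    Measure.addHaar_smul_of_nonneg _ (by linarith), Module.finrank_fin_fun]

lemma ostatExt_openGap {n : ℕ} {σ : Equiv.Perm (Fin n)} {l : ℕ} (hl : l ≤ n) {t : ℝ}
    {ω : Fin n → ℝ} (hω : Tuple.sort ω = σ) (hT : Tuple.sort (openGap σ l t ω) = σ) (k : ℕ) :
    ostatExt (openGap σ l t ω) k = (if k ≤ l then 0 else t) + (1 - t) * ostatExt ω k := by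
  refine ostatExt_cases (n := n) (P := fun k => ostatExt (openGap σ l t ω) k =
    (if k ≤ l then 0 else t) + (1 - t) * ostatExt ω k) ?_ ?_ ?_ k
  · simp [ostatExt_zero]
  · intro k hk
    rw [ostatExt_of_lt _ hk, ostatExt_of_lt _ hk, if_neg (by omega)]
    ring
  · intro k
    rw [ostatExt_val_add_one, ostatExt_val_add_one, hT, hω, openGap_apply_perm]
    rfl

lemma spacing_openGap {n : ℕ} {σ : Equiv.Perm (Fin n)} {l : ℕ} (hl : l ≤ n) {t : ℝ}
    {ω : Fin n → ℝ} (hω : Tuple.sort ω = σ) (hT : Tuple.sort (openGap σ l t ω) = σ) :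
    spacing (openGap σ l t ω) l = t + (1 - t) * spacing ω l := by
  simp only [spacing, ostatExt_openGap hl hω hT]
  rw [if_neg (by omega), if_pos le_rfl]
  ring

/-- The part of the event `{t < φ_l}` inside the cube on which `σ` sorts the sample. -/
def gapEvent {n : ℕ} (σ : Equiv.Perm (Fin n)) (l : ℕ) (t : ℝ) : Set (Fin n → ℝ) :=
  {ω | Tuple.sort ω = σ ∧ t < spacing ω l} ∩ univ.pi fun _ => Icc (0 : ℝ) 1

lemma spacing_le_sub {n : ℕ} {ω : Fin n → ℝ} (hω : ω ∈ univ.pi fun _ => Icc (0 : ℝ) 1)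
    {l : ℕ} {i j : Fin n} (hi : (i : ℕ) < l) (hj : l ≤ j) :
    spacing ω l ≤ ω (Tuple.sort ω j) - ω (Tuple.sort ω i) := by
  rw [← ostatExt_val_add_one ω, ← ostatExt_val_add_one ω, spacing]
  exact sub_le_sub (monotone_ostatExt hω (by omega)) (monotone_ostatExt hω (by omega))

lemma openGap_mem_gapEvent {n : ℕ} {σ : Equiv.Perm (Fin n)} {l : ℕ} (hl : l ≤ n) {t : ℝ}
    (ht0 : 0 ≤ t) (ht1 : t < 1) {ω : Fin n → ℝ} (h : ω ∈ gapEvent σ l 0) :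
    openGap σ l t ω ∈ gapEvent σ l t := by
  obtain ⟨⟨hσ, hpos⟩, hcube⟩ := h
  have hT : Tuple.sort (openGap σ l t ω) = σ := by
    refine sort_eq_of_sort_eq hσ fun i j hij hle => ?_
    rw [openGap_apply_perm, openGap_apply_perm]
    have hij' : (i : ℕ) < j := hij
    refine ⟨?_, fun e => ?_⟩
    · have := mul_le_mul_of_nonneg_left hle (sub_nonneg.2 ht1.le)
      split_ifs <;> first | omega | linarith
    · refine le_antisymm hle (le_of_mul_le_mul_left ?_ (sub_pos.2 ht1))
      revert e
      split_ifs <;> intro e <;> first | omega | linarith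
  refine ⟨⟨hT, ?_⟩, fun i _ => ?_⟩
  · rw [spacing_openGap hl hσ hT]
    have := mul_pos (sub_pos.2 ht1) hpos
    linarith
  · obtain ⟨k, rfl⟩ := σ.surjective i
    rw [openGap_apply_perm]
    obtain ⟨h0, h1⟩ := hcube (σ k) (mem_univ _)
    constructor <;> split_ifs <;> nlinarith

lemma exists_openGap_eq {n : ℕ} {σ : Equiv.Perm (Fin n)} {l : ℕ} (hl : l ≤ n) {t : ℝ}
    (ht1 : t < 1) {v : Fin n → ℝ} (h : v ∈ gapEvent σ l t) :
    ∃ ω ∈ gapEvent σ l 0, openGap σ l t ω = v := by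
  obtain ⟨⟨hσ, hpos⟩, hcube⟩ := h
  have ht : 0 < 1 - t := sub_pos.2 ht1
  obtain ⟨ω, rfl⟩ : ∃ ω, openGap σ l t ω = v := by
    refine ⟨(1 - t)⁻¹ • (v - fun i => if (σ.symm i : ℕ) < l then 0 else t), ?_⟩
    rw [openGap, smul_inv_smul₀ ht.ne', add_sub_cancel]
  refine ⟨ω, ?_, rfl⟩
  have hω : Tuple.sort ω = σ := by
    refine sort_eq_of_sort_eq hσ fun i j hij hle => ?_
    have hij' : (i : ℕ) < j := hij
    have hgap : (i : ℕ) < l → l ≤ j →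
        t < openGap σ l t ω (σ j) - openGap σ l t ω (σ i) := fun hi hj =>
      hpos.trans_le (by simpa only [hσ] using spacing_le_sub hcube hi hj)
    rw [openGap_apply_perm, openGap_apply_perm] at *
    refine ⟨le_of_mul_le_mul_left ?_ ht, fun e => ?_⟩
    · revert hle hgap
      split_ifs <;> intro hle hgap <;> first | omega | linarith | linarith [hgap (by omega) (by omega)]
    · revert hgap
      rw [e]
      split_ifs <;> intro hgap <;> first | omega | rfl | linarith [hgap (by omega) (by omega)]
  refine ⟨⟨hω, ?_⟩, fun i _ => ?_⟩
  · rw [spacing_openGap hl hω hσ] at hpos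
    exact pos_of_mul_pos_right (by linarith) ht.le
  · obtain ⟨k, rfl⟩ := σ.surjective i
    have hk := ostatExt_val_add_one (openGap σ l t ω) k
    rw [hσ, openGap_apply_perm] at hk
    have h01 := hcube (σ k) (mem_univ _)
    rw [openGap_apply_perm] at h01
    obtain ⟨h0, h1⟩ := h01
    rw [spacing] at hpos
    have hmono := monotone_ostatExt hcube
    have hl0 := (ostatExt_mem_Icc hcube l).1
    have hl1 := (ostatExt_mem_Icc hcube (l + 1)).2
    constructor
    · refine nonneg_of_mul_nonneg_right (b := ω (σ k)) ?_ ht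
      split_ifs at hk h0 with hkl
      · linarith
      · have := hmono (show l + 1 ≤ k + 1 by omega)
        linarith
    · refine le_of_mul_le_mul_left ?_ ht
      split_ifs at hk h1 with hkl
      · have := hmono (show (k : ℕ) + 1 ≤ l by omega)
        linarith
      · linarith

lemma image_openGap_gapEvent {n : ℕ} (σ : Equiv.Perm (Fin n)) {l : ℕ} (hl : l ≤ n) {t : ℝ}
    (ht0 : 0 ≤ t) (ht1 : t < 1) : openGap σ l t '' gapEvent σ l 0 = gapEvent σ l t :=
  Subset.antisymm (image_subset_iff.2 fun _ => openGap_mem_gapEvent hl ht0 ht1)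
    fun _ => exists_openGap_eq hl ht1

lemma unifPi_eq_restrict (n : ℕ) :
    unifPi n = volume.restrict (univ.pi fun _ : Fin n => Icc (0 : ℝ) 1) :=
  (Measure.restrict_pi_pi _ _).symm

instance (n : ℕ) : IsProbabilityMeasure (unifPi n) where
  measure_univ := by
    simp [unifPi_eq_restrict, -pi_univ_Icc, volume_pi_pi]

lemma unifPi_spacing_gt_eq_sum (n l : ℕ) (t : ℝ) :
    unifPi n {ω | t < spacing ω l} = ∑ σ : Equiv.Perm (Fin n), volume (gapEvent σ l t) := by
  have hm := measurableSet_lt (measurable_const (a := t)) (measurable_spacing (n := n) l)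
  rw [unifPi_eq_restrict, Measure.restrict_apply hm, ← tsum_fintype (L := .unconditional _),
    ← measure_iUnion]
  · congr 1
    ext ω
    simp [gapEvent]
  · intro σ τ hστ
    refine disjoint_left.2 fun ω h₁ h₂ => hστ ?_
    exact h₁.1.1.symm.trans h₂.1.1
  · exact fun σ => ((measurableSet_sort_eq σ).inter hm).inter
      (.univ_pi fun _ => measurableSet_Icc)

lemma unifPi_spacing_gt_eq_mul {n l : ℕ} (hl : l ≤ n) {t : ℝ} (ht0 : 0 ≤ t) (ht1 : t < 1) :
    unifPi n {ω | t < spacing ω l} =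
      ENNReal.ofReal ((1 - t) ^ n) * unifPi n {ω | 0 < spacing ω l} := by
  rw [unifPi_spacing_gt_eq_sum, unifPi_spacing_gt_eq_sum, Finset.mul_sum]
  refine Finset.sum_congr rfl fun σ _ => ?_
  rw [← image_openGap_gapEvent σ hl ht0 ht1, volume_image_openGap σ l ht1.le]

lemma ae_apply_ne {n : ℕ} {i j : Fin n} (hij : i ≠ j) :
    ∀ᵐ ω : Fin n → ℝ, ω i ≠ ω j := by
  let f : (Fin n → ℝ) →ₗ[ℝ] ℝ := (LinearMap.proj i : (Fin n → ℝ) →ₗ[ℝ] ℝ) - LinearMap.proj j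
  have hf : LinearMap.ker f ≠ ⊤ := by
    intro h
    have := LinearMap.congr_fun (LinearMap.ker_eq_top.1 h) (Pi.single i 1)
    simp [f, hij.symm] at this
  have h0 := Measure.addHaar_submodule volume _ hf
  rw [ae_iff]
  convert h0 using 2
  ext ω
  simp [f, sub_eq_zero]

lemma ae_spacing_pos {n l : ℕ} (hn : 0 < n) (hl : l ≤ n) :
    ∀ᵐ ω ∂unifPi n, 0 < spacing ω l := by
  have hties : ∀ᵐ ω : Fin n → ℝ, ∀ i j, i ≠ j → ω i ≠ ω j :=
    ae_all_iff.2 fun i => ae_all_iff.2 fun j => by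
      by_cases hij : i = j
      · simp [hij]
      · filter_upwards [ae_apply_ne hij] with ω h _ using h
  have hne (a : ℝ) : ∀ᵐ ω : Fin n → ℝ, ∀ i, ω i ≠ a :=
    ae_all_iff.2 fun i => Measure.ae_eval_ne (α := fun _ => ℝ) (μ := fun _ : Fin n => volume) i a
  rw [unifPi_eq_restrict]
  filter_upwards [ae_restrict_of_ae hties, ae_restrict_of_ae (hne 0), ae_restrict_of_ae (hne 1),
    ae_restrict_mem (.univ_pi fun _ => measurableSet_Icc)] with ω h h0 h1 hcube
  refine sub_pos.2 (lt_of_le_of_ne (monotone_ostatExt hcube l.le_succ) ?_)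
  rcases l with _ | l
  · rw [ostatExt_zero, ostatExt_val_add_one ω ⟨0, hn⟩]
    exact (h0 _).symm
  · rw [ostatExt_val_add_one ω ⟨l, hl⟩]
    rcases hl.lt_or_eq with hl' | rfl
    · rw [ostatExt_val_add_one ω ⟨l + 1, hl'⟩]
      exact h _ _ ((Tuple.sort ω).injective.ne (by simp))
    · rw [ostatExt_of_lt ω (Nat.lt_succ_self _)]
      exact h1 _

lemma unifPi_spacing_gt {n l : ℕ} (hn : 0 < n) (hl : l ≤ n) {t : ℝ} (ht0 : 0 ≤ t) (ht1 : t < 1) :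
    unifPi n {ω | t < spacing ω l} = ENNReal.ofReal ((1 - t) ^ n) := by
  have hpos : unifPi n {ω | 0 < spacing ω l} = 1 :=
    (prob_compl_eq_zero_iff (measurableSet_lt measurable_const (measurable_spacing l))).1
      (ae_spacing_pos hn hl)
  rw [unifPi_spacing_gt_eq_mul hl ht0 ht1, hpos, mul_one]

lemma beta_one_left {b : ℝ} (hb : 0 < b) : beta 1 b = b⁻¹ := by
  rw [beta, Real.Gamma_one, add_comm, Real.Gamma_add_one hb.ne', one_mul]
  field_simp [(Real.Gamma_pos_of_pos hb).ne']

lemma betaMeasure_one_Iic {n : ℕ} (hn : 0 < n) {t : ℝ} (ht0 : 0 ≤ t) (ht1 : t < 1) :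
    betaMeasure 1 n (Iic t) = ENNReal.ofReal (1 - (1 - t) ^ n) := by
  have hpdf : ∀ x ∈ Ioc 0 t, betaPDF 1 n x = ENNReal.ofReal (n * (1 - x) ^ (n - 1)) := by
    intro x hx
    rw [betaPDF_of_pos_lt_one hx.1 (hx.2.trans_lt ht1), beta_one_left (by positivity),
      ← Real.rpow_natCast (1 - x), Nat.cast_pred hn]
    simp
  have hderiv : ∀ x ∈ uIcc 0 t,
      HasDerivAt (fun x : ℝ => -(1 - x) ^ n) (n * (1 - x) ^ (n - 1)) x := by
    intro x _
    have := (((hasDerivAt_id' x).const_sub 1).pow n).neg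
    rwa [mul_neg_one, neg_neg] at this
  have hint : ∫ x in 0..t, (n : ℝ) * (1 - x) ^ (n - 1) = 1 - (1 - t) ^ n := by
    rw [intervalIntegral.integral_eq_sub_of_hasDerivAt hderiv
      (Continuous.intervalIntegrable (by fun_prop) _ _)]
    ring
  have hsplit : Iic t = Iic 0 ∪ Ioc 0 t := (Iic_union_Ioc_eq_Iic ht0).symm
  rw [betaMeasure, withDensity_apply _ measurableSet_Iic, hsplit,
    lintegral_union measurableSet_Ioc (Iic_disjoint_Ioc le_rfl),
    setLIntegral_eq_zero measurableSet_Iic fun x hx => betaPDF_eq_zero_of_nonpos hx, zero_add,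
    setLIntegral_congr_fun measurableSet_Ioc hpdf, ← ofReal_integral_eq_lintegral_ofReal,
    ← intervalIntegral.integral_of_le ht0, hint]
  · exact (Continuous.intervalIntegrable (by fun_prop) 0 t).1
  · refine ae_restrict_of_forall_mem measurableSet_Ioc fun x hx => ?_
    have : 0 ≤ 1 - x := by linarith [hx.2]
    positivity

lemma map_spacing_unifPi {n l : ℕ} (hn : 0 < n) (hl : l ≤ n) :
    (unifPi n).map (fun ω => spacing ω l) = betaMeasure 1 n := by
  have hm := measurable_spacing (n := n) l
  have := Measure.isProbabilityMeasure_map (μ := unifPi n) hm.aemeasurable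
  have := isProbabilityMeasureBeta (α := 1) (β := n) one_pos (by positivity)
  have hIic {t : ℝ} (ht0 : 0 ≤ t) (ht1 : t < 1) :
      (unifPi n).map (fun ω => spacing ω l) (Iic t) = ENNReal.ofReal (1 - (1 - t) ^ n) := by
    rw [← compl_Ioi, prob_compl_eq_one_sub measurableSet_Ioi, Measure.map_apply hm measurableSet_Ioi,
      ENNReal.ofReal_sub _ (pow_nonneg (sub_nonneg.2 ht1.le) _), ENNReal.ofReal_one,
      ← unifPi_spacing_gt hn hl ht0 ht1]
    rfl
  refine Measure.ext_of_Iic _ _ fun t => ?_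
  rcases lt_or_ge t 0 with ht0 | ht0
  · have hle : Iic t ⊆ Iic 0 := Iic_subset_Iic.2 ht0.le
    rw [measure_mono_null hle, measure_mono_null hle]
    · simpa using betaMeasure_one_Iic hn le_rfl one_pos
    · simpa using hIic le_rfl one_pos
  rcases lt_or_ge t 1 with ht1 | ht1
  · rw [hIic ht0 ht1, betaMeasure_one_Iic hn ht0 ht1]
  · have hbeta : betaMeasure 1 n (Ioi t) = 0 := by
      rw [betaMeasure, withDensity_apply _ measurableSet_Ioi]
      exact setLIntegral_eq_zero measurableSet_Ioi fun x hx =>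
        betaPDF_eq_zero_of_one_le (ht1.trans (mem_Ioi.1 hx).le)
    have hmap : (unifPi n).map (fun ω => spacing ω l) (Ioi t) = 0 := by
      rw [Measure.map_apply hm measurableSet_Ioi, ← compl_Iic, preimage_compl]
      have : ∀ᵐ ω ∂unifPi n, spacing ω l ≤ t := by
        rw [unifPi_eq_restrict]
        filter_upwards [ae_restrict_mem (.univ_pi fun _ => measurableSet_Icc)] with ω hω
        have h0 := (ostatExt_mem_Icc hω l).1
        have h1 := (ostatExt_mem_Icc hω (l + 1)).2
        rw [spacing]
        linarith
      exact this
    rw [← compl_Ioi, prob_compl_eq_one_sub measurableSet_Ioi,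
      prob_compl_eq_one_sub measurableSet_Ioi, hmap, hbeta]

lemma integral_rpow_betaMeasure_one {b p : ℝ} (hb : 0 < b) (hp : -1 < p) :
    ∫ x, x ^ p ∂betaMeasure 1 b = beta (1 + p) b / beta 1 b := by
  have hpb : 0 < 1 + p := by linarith
  have := (beta_pos hpb hb).ne'
  have hone : ∫ x, betaPDFReal (1 + p) b x = 1 := by
    rw [integral_eq_lintegral_of_nonneg_ae]
    · exact ENNReal.toReal_eq_one_iff _ |>.2 (lintegral_betaPDF_eq_one hpb hb)
    · refine .of_forall fun x => ?_
      by_cases hx : 0 < x ∧ x < 1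
      · exact (betaPDFReal_pos hx.1 hx.2 hpb hb).le
      · simp [betaPDFReal, hx]
    · fun_prop
  rw [betaMeasure, show betaPDF 1 b = fun x => ENNReal.ofReal (betaPDFReal 1 b x) from rfl,
    integral_withDensity_eq_integral_toReal_smul
      (measurable_betaPDFReal 1 b).ennreal_ofReal (.of_forall fun _ => ENNReal.ofReal_lt_top),
    show beta (1 + p) b / beta 1 b = beta (1 + p) b / beta 1 b * ∫ x, betaPDFReal (1 + p) b x by
      rw [hone, mul_one], ← integral_const_mul]
  refine integral_congr_ae (.of_forall fun x => ?_)
  by_cases hx : 0 < x ∧ x < 1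
  · simp only [smul_eq_mul]
    rw [ENNReal.toReal_ofReal (betaPDFReal_pos hx.1 hx.2 one_pos hb).le]
    simp only [betaPDFReal, if_pos hx, sub_self, Real.rpow_zero, add_sub_cancel_left]
    field_simp
  · simp [betaPDFReal, hx]

/-- For a uniform sample of `2N` points and `p > −1`,
`E[φ_l^p] = Γ(2N+1)Γ(1+p)/Γ(2N+1+p)` for every spacing `φ_l`. -/
theorem spacing_power_moment {N : ℕ} (hN : 0 < N) (p : ℝ) (hp : -1 < p)
    (l : ℕ) (hl : l ≤ 2 * N) :
    ∫ ω, spacing ω l ^ p ∂(unifPi (2 * N)) =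
      Real.Gamma (2 * N + 1) * Real.Gamma (1 + p) /
        Real.Gamma (2 * N + 1 + p) := by
  have hn : 0 < 2 * N := by omega
  have hb : (0 : ℝ) < (2 * N : ℕ) := by positivity
  rw [← integral_map (φ := fun ω => spacing ω l) (f := fun x : ℝ => x ^ p)
      (measurable_spacing l).aemeasurable (Measurable.aestronglyMeasurable (by fun_prop)),
    map_spacing_unifPi hn hl, integral_rpow_betaMeasure_one hb hp, beta_one_left hb, beta,
    show (2 * N + 1 : ℝ) = (2 * N : ℕ) + 1 by push_cast; ring, Real.Gamma_add_one hb.ne',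
    show ((2 * N : ℕ) + 1 + p : ℝ) = 1 + p + (2 * N : ℕ) by ring]
  field_simp
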